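/- Let m ∈ {1, 2, 3} and let j be a positive integer with j < 12/m and gcd(j, 12/m) = 1. Then 2^{1 − mj/6} · P(mj/12, 1/2 + mj/24) = P(mj/24, 1 − mj/24) + P(1/2 + mj/24, 3/2 − mj/24), and 2^{1 − mj/6} · P(mj/12, 1 + mj/24) = P(mj/24, 1 − mj/24) − P(1/2 + mj/24, 3/2 − mj/24). -/

import Mathlib

open Real

/-- Ascending Pochhammer symbol `(x)_k = x(x+1)⋯(x+k−1)`. -/
noncomputable def poch (x : ℝ) (k : ℕ) : ℝ := (ascPochhammer ℝ k).eval x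

/-- The Beta function quotient `B(x,y) = Γ(x)Γ(y)/Γ(x+y)`. -/
noncomputable def betaR (x y : ℝ) : ℝ := Gamma x * Gamma y / Gamma (x + y)

/-- Generalized hypergeometric series `₃F₂(a₁,a₂,a₃; b₁,b₂; z)`. -/
noncomputable def F32 (a1 a2 a3 b1 b2 z : ℝ) : ℝ :=
  ∑' k : ℕ, (poch a1 k * poch a2 k * poch a3 k)
      / (poch b1 k * poch b2 k * (k.factorial : ℝ)) * z ^ k

/-- The hypergeometric period value `P(r,s) = π · B(r, s−r) · ₃F₂(1/2,1/2,r; 1,s; 1)`. -/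
noncomputable def P (r s : ℝ) : ℝ := π * betaR r (s - r) * F32 (1/2) (1/2) r 1 s 1

/-- The coefficient `(1/2)_k / k!` of the binomial series of `(1 - z) ^ (-1/2)`. -/
noncomputable def halfCoeff (k : ℕ) : ℝ := poch (1 / 2) k / k.factorial

lemma poch_succ (x : ℝ) (k : ℕ) : poch x (k + 1) = poch x k * (x + k) := by
  simp [poch, ascPochhammer_succ_eval]

lemma poch_pos {x : ℝ} (hx : 0 < x) (k : ℕ) : 0 < poch x k :=
  ascPochhammer_pos k x hx

lemma poch_one (k : ℕ) : poch 1 k = k.factorial := by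
  simp [poch]

lemma Gamma_add_nat {x : ℝ} (hx : 0 < x) (k : ℕ) : Gamma (x + k) = poch x k * Gamma x := by
  induction k with
  | zero => simp [poch]
  | succ k ih =>
    rw [Nat.cast_succ, ← add_assoc, Gamma_add_one (by positivity), ih, poch_succ]
    ring

lemma halfCoeff_zero : halfCoeff 0 = 1 := by simp [halfCoeff, poch]

lemma halfCoeff_succ (k : ℕ) :
    halfCoeff (k + 1) = halfCoeff k * ((2 * k + 1) / (2 * k + 2)) := by
  have h : (k.factorial : ℝ) ≠ 0 := by positivity
  simp only [halfCoeff, poch_succ, Nat.factorial_succ, Nat.cast_mul, Nat.cast_succ]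
  field_simp
  ring

lemma halfCoeff_pos (k : ℕ) : 0 < halfCoeff k :=
  div_pos (poch_pos (by norm_num) k) (by positivity)

lemma halfCoeff_eq_prod (k : ℕ) :
    halfCoeff k = ∏ i ∈ Finset.range k, (2 * (i : ℝ) + 1) / (2 * i + 2) := by
  induction k with
  | zero => simp [halfCoeff_zero]
  | succ k ih => rw [halfCoeff_succ, Finset.prod_range_succ, ih]

lemma halfCoeff_sq_mul_le_one (k : ℕ) : halfCoeff k ^ 2 * (2 * k + 1) ≤ 1 := by
  induction k with
  | zero => simp [halfCoeff_zero]
  | succ k ih =>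
    refine le_trans ?_ ih
    rw [halfCoeff_succ, mul_pow, mul_assoc]
    gcongr
    push_cast
    rw [div_pow, div_mul_eq_mul_div, div_le_iff₀ (by positivity)]
    nlinarith [Nat.cast_nonneg (α := ℝ) k]

lemma halfCoeff_le_one (k : ℕ) : halfCoeff k ≤ 1 := by
  have h := halfCoeff_sq_mul_le_one k
  have := halfCoeff_pos k
  by_contra! hlt
  nlinarith [Nat.cast_nonneg (α := ℝ) k, mul_nonneg (sq_nonneg (halfCoeff k)) k.cast_nonneg]

lemma summable_halfCoeff_mul_pow {x : ℝ} (h0 : 0 ≤ x) (h1 : x < 1) :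
    Summable fun k : ℕ ↦ halfCoeff k * x ^ k :=
  (summable_geometric_of_lt_one h0 h1).of_nonneg_of_le
    (fun k ↦ mul_nonneg (halfCoeff_pos k).le (pow_nonneg h0 k))
    fun k ↦ mul_le_of_le_one_left (pow_nonneg h0 k) (halfCoeff_le_one k)

lemma summable_halfCoeff_sq_mul_pow {x : ℝ} (h0 : 0 ≤ x) (h1 : x < 1) :
    Summable fun k : ℕ ↦ halfCoeff k ^ 2 * x ^ k :=
  (summable_geometric_of_lt_one h0 h1).of_nonneg_of_le
    (fun k ↦ mul_nonneg (sq_nonneg _) (pow_nonneg h0 k))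
    fun k ↦ mul_le_of_le_one_left (pow_nonneg h0 k)
      (pow_le_one₀ (halfCoeff_pos k).le (halfCoeff_le_one k))

lemma hasSum_halfCoeff_mul_pow {z : ℂ} (hz : ‖z‖ < 1) :
    HasSum (fun k : ℕ ↦ (halfCoeff k : ℂ) * z ^ k) (1 / (1 - z) ^ (1 / 2 : ℂ)) := by
  have h := (Complex.one_div_one_sub_cpow_hasFPowerSeriesOnBall_zero (1 / 2)).hasSum (y := z)
    (by simpa [Metric.mem_eball, edist_zero_right, enorm_eq_nnnorm, ← NNReal.coe_lt_coe] using hz)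
  have hcoeff (k : ℕ) : Ring.choose (1 / 2 + k - 1 : ℂ) k = halfCoeff k := by
    have hk : (k.factorial : ℂ) ≠ 0 := by exact_mod_cast k.factorial_ne_zero
    have hchoose := Ring.factorial_nsmul_multichoose_eq_ascPochhammer (1 / 2 : ℂ) k
    rw [Ring.multichoose_eq, Polynomial.ascPochhammer_smeval_eq_eval, nsmul_eq_mul] at hchoose
    have hmap := Polynomial.eval_map_apply (p := ascPochhammer ℝ k) (f := Complex.ofRealHom) (1 / 2)
    rw [ascPochhammer_map] at hmap
    rw [eq_div_of_mul_eq hk ((mul_comm _ _).trans hchoose), halfCoeff, poch]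
    push_cast
    congr 1
    simpa using hmap
  simp only [FormalMultilinearSeries.ofScalars_apply_eq, zero_add, hcoeff, smul_eq_mul] at h
  exact h

lemma hasSum_halfCoeff_mul_pow_real {x : ℝ} (h0 : 0 ≤ x) (h1 : x < 1) :
    HasSum (fun k : ℕ ↦ halfCoeff k * x ^ k) (√(1 - x))⁻¹ := by
  have h := hasSum_halfCoeff_mul_pow (z := x) (by simpa [abs_of_nonneg h0])
  rw [← Complex.hasSum_ofReal]
  convert h using 1
  · ext; push_cast; rfl
  · rw [sqrt_eq_rpow, Complex.ofReal_inv, Complex.ofReal_cpow (by linarith)]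
    push_cast
    simp

/-- The series `₂F₁(1/2, 1/2; 1; t) = ∑ ((1/2)_k / k!) ^ 2 t ^ k`. -/
noncomputable def ellipticF (t : ℝ) : ℝ := ∑' k : ℕ, halfCoeff k ^ 2 * t ^ k

lemma ellipticF_nonneg {t : ℝ} (ht : 0 ≤ t) : 0 ≤ ellipticF t :=
  tsum_nonneg fun k ↦ mul_nonneg (sq_nonneg _) (pow_nonneg ht k)

lemma integral_inv_sqrt_one_sub_mul_sin_sq {v : ℝ} (h0 : 0 ≤ v) (h1 : v < 1) :
    ∫ θ in (0 : ℝ)..π, (√(1 - v * sin θ ^ 2))⁻¹ = π * ellipticF v := by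
  have hbound : Summable fun k : ℕ ↦ halfCoeff k * v ^ k := summable_halfCoeff_mul_pow h0 h1
  have hsin (θ : ℝ) : v * sin θ ^ 2 ≤ v := mul_le_of_le_one_right h0 (sin_sq_le_one θ)
  have hsum := intervalIntegral.hasSum_integral_of_dominated_convergence
    (a := 0) (b := π) (μ := MeasureTheory.volume)
    (F := fun (k : ℕ) θ ↦ halfCoeff k * (v * sin θ ^ 2) ^ k)
    (f := fun θ ↦ (√(1 - v * sin θ ^ 2))⁻¹)
    (fun k _ ↦ halfCoeff k * v ^ k)
    (fun k ↦ (by fun_prop : Continuous _).aestronglyMeasurable)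
    (fun k ↦ .of_forall fun θ _ ↦ by
      rw [norm_of_nonneg (by have := (halfCoeff_pos k).le; positivity)]
      have := (halfCoeff_pos k).le
      gcongr
      exact hsin θ)
    (.of_forall fun θ _ ↦ hbound) intervalIntegrable_const
    (.of_forall fun θ _ ↦
      hasSum_halfCoeff_mul_pow_real (by positivity) ((hsin θ).trans_lt h1))
  rw [← hsum.tsum_eq, ellipticF, ← tsum_mul_left]
  congr 1 with k
  simp_rw [mul_pow, ← pow_mul]
  rw [intervalIntegral.integral_const_mul, intervalIntegral.integral_const_mul,
    integral_sin_pow_even, ← halfCoeff_eq_prod]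
  ring

lemma integral_exp_two_mul_int_mul_I {n : ℤ} (hn : n ≠ 0) :
    ∫ θ in (0 : ℝ)..π, Complex.exp (2 * n * Complex.I * θ) = 0 := by
  rw [integral_exp_mul_complex (by simp [hn])]
  have : (2 * n * Complex.I * π : ℂ) = n * (2 * π * Complex.I) := by ring
  simp [this, Complex.exp_int_mul_two_pi_mul_I]

lemma integral_pow_mul_conj_pow (u : ℝ) (j k : ℕ) :
    ∫ θ in (0 : ℝ)..π, (-u * Complex.exp (2 * Complex.I * θ)) ^ j *
      (starRingEnd ℂ (-u * Complex.exp (2 * Complex.I * θ))) ^ k =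
      if j = k then (π * (u ^ 2) ^ k : ℂ) else 0 := by
  have h (θ : ℝ) : (-u * Complex.exp (2 * Complex.I * θ)) ^ j *
      (starRingEnd ℂ (-u * Complex.exp (2 * Complex.I * θ))) ^ k =
      (-u : ℂ) ^ (j + k) * Complex.exp (2 * ((j - k : ℤ) : ℂ) * Complex.I * θ) := by
    simp only [map_mul, map_neg, ← Complex.exp_conj, Complex.conj_ofReal, Complex.conj_I,
      map_ofNat, mul_pow, ← Complex.exp_nat_mul]
    rw [mul_mul_mul_comm, ← pow_add, ← Complex.exp_add]
    congr 2
    push_cast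
    ring
  simp_rw [h]
  rw [intervalIntegral.integral_const_mul]
  split_ifs with hjk
  · subst hjk
    simp only [sub_self, Int.cast_zero, mul_zero, zero_mul, Complex.exp_zero,
      intervalIntegral.integral_const, sub_zero, Complex.real_smul, mul_one]
    rw [← two_mul, pow_mul, neg_sq, mul_comm]
  · rw [integral_exp_two_mul_int_mul_I (by omega), mul_zero]

lemma inv_sqrt_mul_inv_sqrt_conj (w : ℂ) :
    1 / w ^ (1 / 2 : ℂ) * starRingEnd ℂ (1 / w ^ (1 / 2 : ℂ)) = ((‖w‖⁻¹ : ℝ) : ℂ) := by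
  rw [Complex.mul_conj, Complex.normSq_eq_norm_sq, ← norm_pow, div_pow, ← Complex.cpow_nat_mul]
  simp

lemma summable_norm_halfCoeff_mul_pow {z : ℂ} (hz : ‖z‖ < 1) :
    Summable fun k : ℕ ↦ ‖(halfCoeff k : ℂ) * z ^ k‖ := by
  simpa [abs_of_pos (halfCoeff_pos _)] using summable_halfCoeff_mul_pow (norm_nonneg z) hz

lemma hasSum_mul_of_summable_norm {f g : ℕ → ℂ} {a b : ℂ} (hf : HasSum f a) (hg : HasSum g b)
    (hf' : Summable fun k ↦ ‖f k‖) (hg' : Summable fun k ↦ ‖g k‖) :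
    HasSum (fun p : ℕ × ℕ ↦ f p.1 * g p.2) (a * b) :=
  hf.mul hg (summable_mul_of_summable_norm hf' hg')

lemma hasSum_halfCoeff_mul_conj {z : ℂ} (hz : ‖z‖ < 1) :
    HasSum (fun p : ℕ × ℕ ↦ ((halfCoeff p.1 : ℂ) * z ^ p.1) *
      ((halfCoeff p.2 : ℂ) * (starRingEnd ℂ z) ^ p.2)) ((‖1 - z‖⁻¹ : ℝ) : ℂ) := by
  have h := hasSum_halfCoeff_mul_pow hz
  have hz' : ‖starRingEnd ℂ z‖ < 1 := by rwa [RCLike.norm_conj]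
  have h' : HasSum (fun k : ℕ ↦ (halfCoeff k : ℂ) * (starRingEnd ℂ z) ^ k)
      (starRingEnd ℂ (1 / (1 - z) ^ (1 / 2 : ℂ))) := by
    simpa using Complex.hasSum_conj'.2 h
  have hmul := hasSum_mul_of_summable_norm h h' (summable_norm_halfCoeff_mul_pow hz)
    (summable_norm_halfCoeff_mul_pow hz')
  rwa [inv_sqrt_mul_inv_sqrt_conj] at hmul

lemma norm_one_add_mul_exp (u θ : ℝ) :
    ‖1 - (-u * Complex.exp (2 * Complex.I * θ))‖ = √((1 + u) ^ 2 - 4 * u * sin θ ^ 2) := by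
  have he : Complex.exp (2 * Complex.I * θ) = ⟨cos (2 * θ), sin (2 * θ)⟩ := by
    apply Complex.ext <;> simp [Complex.exp_re, Complex.exp_im]
  rw [Complex.norm_def, he]
  congr 1
  simp only [Complex.normSq_apply, Complex.sub_re, Complex.sub_im, Complex.mul_re, Complex.mul_im,
    Complex.neg_re, Complex.neg_im, Complex.ofReal_re, Complex.ofReal_im, Complex.one_re,
    Complex.one_im]
  have h1 := sin_sq_add_cos_sq (2 * θ)
  have h2 : cos (2 * θ) = 1 - 2 * sin θ ^ 2 := by rw [cos_two_mul, cos_sq']; ring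
  linear_combination u ^ 2 * h1 + 2 * u * h2

lemma integral_inv_sqrt_sub_four_mul_sin_sq {u : ℝ} (h0 : 0 ≤ u) (h1 : u < 1) :
    ∫ θ in (0 : ℝ)..π, (√((1 + u) ^ 2 - 4 * u * sin θ ^ 2))⁻¹ = π * ellipticF (u ^ 2) := by
  set w : ℝ → ℂ := fun θ ↦ -u * Complex.exp (2 * Complex.I * θ) with hw
  have hnorm (θ : ℝ) : ‖w θ‖ = u := by
    have : (2 * Complex.I * θ : ℂ) = ((2 * θ : ℝ) : ℂ) * Complex.I := by push_cast; ring
    simp only [hw]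
    rw [this, norm_mul, Complex.norm_exp_ofReal_mul_I]
    simp [abs_of_nonneg h0]
  have hcont : Continuous w := by fun_prop
  have hbound : Summable fun p : ℕ × ℕ ↦ (halfCoeff p.1 * u ^ p.1) * (halfCoeff p.2 * u ^ p.2) := by
    have h := summable_halfCoeff_mul_pow h0 h1
    exact h.mul_of_nonneg h (fun k ↦ mul_nonneg (halfCoeff_pos k).le (pow_nonneg h0 k))
      fun k ↦ mul_nonneg (halfCoeff_pos k).le (pow_nonneg h0 k)
  have hsum := intervalIntegral.hasSum_integral_of_dominated_convergence
    (a := 0) (b := π) (μ := MeasureTheory.volume)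
    (F := fun (p : ℕ × ℕ) θ ↦ ((halfCoeff p.1 : ℂ) * w θ ^ p.1) *
      ((halfCoeff p.2 : ℂ) * (starRingEnd ℂ (w θ)) ^ p.2))
    (f := fun θ ↦ ((‖1 - w θ‖⁻¹ : ℝ) : ℂ))
    (fun p _ ↦ (halfCoeff p.1 * u ^ p.1) * (halfCoeff p.2 * u ^ p.2))
    (fun p ↦ (by fun_prop : Continuous _).aestronglyMeasurable)
    (fun p ↦ .of_forall fun θ _ ↦ by
      simp [hnorm, abs_of_pos (halfCoeff_pos _)])
    (.of_forall fun θ _ ↦ hbound) intervalIntegrable_const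
    (.of_forall fun θ _ ↦ hasSum_halfCoeff_mul_conj (by rwa [hnorm]))
  have hint (p : ℕ × ℕ) : ∫ θ in (0 : ℝ)..π, ((halfCoeff p.1 : ℂ) * w θ ^ p.1) *
      ((halfCoeff p.2 : ℂ) * (starRingEnd ℂ (w θ)) ^ p.2) =
      if p.1 = p.2 then ((π * (halfCoeff p.2 ^ 2 * (u ^ 2) ^ p.2) : ℝ) : ℂ) else 0 := by
    simp_rw [mul_mul_mul_comm]
    rw [intervalIntegral.integral_const_mul, integral_pow_mul_conj_pow]
    split_ifs with h
    · rw [h]; push_cast; ring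
    · simp
  simp_rw [hint] at hsum
  rw [← (show Function.Injective fun k : ℕ ↦ (k, k) from fun a b h ↦ (Prod.ext_iff.1 h).1).hasSum_iff
    (by rintro ⟨a, b⟩ h; exact if_neg fun hab : a = b ↦ h ⟨a, by simp [hab]⟩)] at hsum
  simp only [Function.comp_def, if_true, intervalIntegral.integral_ofReal] at hsum
  rw [Complex.hasSum_ofReal] at hsum
  simp only [hw, norm_one_add_mul_exp] at hsum
  rw [← hsum.tsum_eq, tsum_mul_left, ellipticF]

/-- **Landen's transformation** for the complete elliptic integral of the first kind. -/
lemma ellipticF_landen {u : ℝ} (h0 : 0 ≤ u) (h1 : u < 1) :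
    ellipticF (4 * u / (1 + u) ^ 2) = (1 + u) * ellipticF (u ^ 2) := by
  have hv : 4 * u / (1 + u) ^ 2 < 1 := by
    rw [div_lt_one (by positivity)]
    nlinarith [sq_pos_of_pos (sub_pos.2 h1)]
  have h : π * ellipticF (4 * u / (1 + u) ^ 2) = π * ((1 + u) * ellipticF (u ^ 2)) := by
    rw [mul_left_comm, ← integral_inv_sqrt_sub_four_mul_sin_sq h0 h1,
      ← integral_inv_sqrt_one_sub_mul_sin_sq (by positivity) hv,
      ← intervalIntegral.integral_const_mul]
    congr 1 with θ
    have : (1 + u) ^ 2 - 4 * u * sin θ ^ 2 =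
        (1 + u) ^ 2 * (1 - 4 * u / (1 + u) ^ 2 * sin θ ^ 2) := by field_simp
    rw [this, sqrt_mul (by positivity), sqrt_sq (by positivity), mul_inv,
      mul_inv_cancel_left₀ (by positivity)]
  exact mul_left_cancel₀ pi_ne_zero h

lemma lintegral_rpow_mul_one_sub_rpow {a b : ℝ} (ha : 0 < a) (hb : 0 < b) :
    ∫⁻ t in Set.Ioo (0 : ℝ) 1, ENNReal.ofReal (t ^ (a - 1) * (1 - t) ^ (b - 1)) =
      ENNReal.ofReal (betaR a b) := by
  have hpos : 0 < betaR a b := ProbabilityTheory.beta_pos ha hb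
  have h := ProbabilityTheory.lintegral_betaPDF_eq_one ha hb
  rw [ProbabilityTheory.lintegral_betaPDF] at h
  rw [← mul_one (ENNReal.ofReal (betaR a b)), ← h,
    ← MeasureTheory.lintegral_const_mul' _ _ ENNReal.ofReal_ne_top]
  congr 1 with t
  rw [← ENNReal.ofReal_mul hpos.le, mul_assoc, one_div]
  exact congrArg _ (mul_inv_cancel_left₀ hpos.ne' _).symm

lemma betaR_add_nat {r d : ℝ} (hr : 0 < r) (hd : 0 < d) (k : ℕ) :
    betaR (r + k) d = betaR r d * (poch r k / poch (r + d) k) := by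
  have h : r + k + d = r + d + k := by ring
  rw [betaR, betaR, h, Gamma_add_nat hr, Gamma_add_nat (add_pos hr hd)]
  ring

lemma summable_poch_div_poch_div {r s : ℝ} (hr : 0 < r) (hrs : r < s) :
    Summable fun k : ℕ ↦ poch r k / poch s k / (s + k) := by
  have hs : 0 < s := hr.trans hrs
  have hsum (n : ℕ) : ∑ k ∈ Finset.range n, poch r k / poch s k / (s + k) =
      (1 - poch r n / poch s n) / (s - r) := by
    have hsr : s - r ≠ 0 := (sub_pos.2 hrs).ne'
    induction n with
    | zero => simp [poch]
    | succ n ih =>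
      have h1 := (poch_pos hs n).ne'
      have h2 : s + n ≠ 0 := by positivity
      rw [Finset.sum_range_succ, ih, poch_succ, poch_succ]
      field_simp
      ring
  refine summable_of_sum_range_le (c := 1 / (s - r)) (fun k ↦ ?_) fun n ↦ ?_
  · have := poch_pos hr k
    have := poch_pos hs k
    positivity
  · rw [hsum]
    have := sub_pos.2 hrs
    have := div_pos (poch_pos hr n) (poch_pos hs n)
    gcongr
    linarith

lemma summable_halfCoeff_sq_mul_poch {r s : ℝ} (hr : 0 < r) (hrs : r < s) :
    Summable fun k : ℕ ↦ halfCoeff k ^ 2 * (poch r k / poch s k) := by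
  have hs : 0 < s := hr.trans hrs
  refine ((summable_poch_div_poch_div hr hrs).mul_left (s + 1)).of_nonneg_of_le (fun k ↦ ?_)
    fun k ↦ ?_
  · have := poch_pos hr k
    have := poch_pos hs k
    positivity
  · have h := div_pos (poch_pos hr k) (poch_pos hs k)
    have hk : 0 < s + k := by positivity
    have hc := halfCoeff_sq_mul_le_one k
    have hc1 : halfCoeff k ^ 2 ≤ 1 := pow_le_one₀ (halfCoeff_pos k).le (halfCoeff_le_one k)
    rw [← mul_div_assoc (s + 1), le_div_iff₀ hk]
    have : halfCoeff k ^ 2 * (s + k) ≤ s + 1 := by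
      nlinarith [mul_nonneg (sq_nonneg (halfCoeff k)) k.cast_nonneg]
    calc _ = halfCoeff k ^ 2 * (s + k) * (poch r k / poch s k) := by ring
      _ ≤ _ := by gcongr

lemma F32_half_half (r s : ℝ) :
    F32 (1 / 2) (1 / 2) r 1 s 1 = ∑' k : ℕ, halfCoeff k ^ 2 * (poch r k / poch s k) := by
  refine tsum_congr fun k ↦ ?_
  rw [poch_one, halfCoeff, one_pow, mul_one, div_pow, div_mul_div_comm]
  ring

lemma P_nonneg {r s : ℝ} (hr : 0 < r) (hrs : r < s) : 0 ≤ P r s := by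
  have hb : 0 < betaR r (s - r) := ProbabilityTheory.beta_pos hr (sub_pos.2 hrs)
  rw [P, F32_half_half]
  refine mul_nonneg (by positivity) (tsum_nonneg fun k ↦ ?_)
  have := poch_pos hr k
  have := poch_pos (hr.trans hrs) k
  positivity

/-- Euler's integral for `P r s`. -/
lemma ofReal_P {r s : ℝ} (hr : 0 < r) (hrs : r < s) :
    ENNReal.ofReal (P r s) = ∫⁻ t in Set.Ioo (0 : ℝ) 1,
      ENNReal.ofReal (t ^ (r - 1) * (1 - t) ^ (s - r - 1) * (π * ellipticF t)) := by
  have hd : 0 < s - r := sub_pos.2 hrs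
  have hb : 0 < betaR r (s - r) := ProbabilityTheory.beta_pos hr hd
  have hterm (k : ℕ) : 0 ≤ π * betaR r (s - r) * (halfCoeff k ^ 2 * (poch r k / poch s k)) := by
    have := poch_pos hr k
    have := poch_pos (hr.trans hrs) k
    positivity
  have hright : ∀ t ∈ Set.Ioo (0 : ℝ) 1,
      ENNReal.ofReal (t ^ (r - 1) * (1 - t) ^ (s - r - 1) * (π * ellipticF t)) =
      ∑' k : ℕ, ENNReal.ofReal (π * halfCoeff k ^ 2) *
        ENNReal.ofReal (t ^ (r + k - 1) * (1 - t) ^ (s - r - 1)) := by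
    rintro t ⟨h0, h1⟩
    have h1' : 0 < 1 - t := sub_pos.2 h1
    rw [ellipticF, ← tsum_mul_left, ← tsum_mul_left, ENNReal.ofReal_tsum_of_nonneg
      (fun k ↦ by positivity)
      (((summable_halfCoeff_sq_mul_pow h0.le h1).mul_left π).mul_left _)]
    congr 1 with k
    rw [← ENNReal.ofReal_mul (by positivity), show r + k - 1 = r - 1 + k by ring,
      rpow_add_natCast h0.ne']
    congr 1
    ring
  rw [MeasureTheory.setLIntegral_congr_fun measurableSet_Ioo hright,
    MeasureTheory.lintegral_tsum (fun k ↦ (by fun_prop : Measurable _).aemeasurable), P,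
    F32_half_half, ← tsum_mul_left, ENNReal.ofReal_tsum_of_nonneg hterm
      ((summable_halfCoeff_sq_mul_poch hr hrs).mul_left _)]
  congr 1 with k
  rw [MeasureTheory.lintegral_const_mul' _ _ ENNReal.ofReal_ne_top,
    lintegral_rpow_mul_one_sub_rpow (by positivity) hd, ← ENNReal.ofReal_mul (by positivity),
    betaR_add_nat hr hd, add_sub_cancel]
  congr 1
  ring

lemma image_sq_Ioo : (fun u : ℝ ↦ u ^ 2) '' Set.Ioo 0 1 = Set.Ioo 0 1 := by
  ext t
  constructor
  · rintro ⟨u, ⟨h0, h1⟩, rfl⟩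
    exact ⟨pow_pos h0 2, pow_lt_one₀ h0.le h1 two_ne_zero⟩
  · rintro ⟨h0, h1⟩
    exact ⟨√t, ⟨sqrt_pos.2 h0, by rwa [sqrt_lt' one_pos, one_pow]⟩, sq_sqrt h0.le⟩

lemma image_landen_Ioo : (fun u : ℝ ↦ 4 * u / (1 + u) ^ 2) '' Set.Ioo 0 1 = Set.Ioo 0 1 := by
  ext t
  constructor
  · rintro ⟨u, ⟨h0, h1⟩, rfl⟩
    refine ⟨by positivity, ?_⟩
    simp only
    rw [div_lt_one (by positivity)]
    nlinarith [sq_pos_of_pos (sub_pos.2 h1)]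
  · rintro ⟨h0, h1⟩
    have hq0 : 0 < √(1 - t) := sqrt_pos.2 (sub_pos.2 h1)
    have hq1 : √(1 - t) < 1 := by rw [sqrt_lt' one_pos]; linarith
    have hq : √(1 - t) ^ 2 = 1 - t := sq_sqrt (sub_pos.2 h1).le
    refine ⟨(1 - √(1 - t)) / (1 + √(1 - t)), ⟨div_pos (sub_pos.2 hq1) (by positivity), ?_⟩, ?_⟩
    · rw [div_lt_one (by positivity)]
      linarith
    · have h : 1 + (1 - √(1 - t)) / (1 + √(1 - t)) = 2 / (1 + √(1 - t)) := by
        field_simp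
        ring
      simp only [h]
      field_simp
      linear_combination -4 * hq

lemma injOn_landen : Set.InjOn (fun u : ℝ ↦ 4 * u / (1 + u) ^ 2) (Set.Ioo 0 1) := by
  rintro u ⟨hu0, hu1⟩ w ⟨hw0, hw1⟩ h
  simp only at h
  rw [div_eq_div_iff (by positivity) (by positivity)] at h
  have huw : (u - w) * (1 - u * w) = 0 := by linear_combination h / 4
  have : 1 - u * w ≠ 0 := by nlinarith
  exact sub_eq_zero.1 ((mul_eq_zero.1 huw).resolve_right this)

lemma hasDerivAt_landen {u : ℝ} (hu : 1 + u ≠ 0) :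
    HasDerivAt (fun u : ℝ ↦ 4 * u / (1 + u) ^ 2) (4 * (1 - u) / (1 + u) ^ 3) u := by
  have h := ((hasDerivAt_id' u).const_mul 4).div (((hasDerivAt_id' u).const_add 1).pow 2)
    (pow_ne_zero 2 hu)
  refine h.congr_deriv ?_
  simp only [Pi.pow_apply]
  field_simp
  ring

lemma ofReal_P_eq_lintegral_sq {r s : ℝ} (hr : 0 < r) (hrs : r < s) :
    ENNReal.ofReal (P r s) = ∫⁻ u in Set.Ioo (0 : ℝ) 1, ENNReal.ofReal
      (2 * u ^ (2 * r - 1) * (1 - u) ^ (s - r - 1) * (1 + u) ^ (s - r - 1) *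
        (π * ellipticF (u ^ 2))) := by
  have hinj : Set.InjOn (fun u : ℝ ↦ u ^ 2) (Set.Ioo 0 1) := fun u hu w hw h ↦
    (pow_left_inj₀ hu.1.le hw.1.le two_ne_zero).1 h
  have hderiv : ∀ u ∈ Set.Ioo (0 : ℝ) 1,
      HasDerivWithinAt (fun u : ℝ ↦ u ^ 2) (2 * u) (Set.Ioo 0 1) u := fun u _ ↦ by
    simpa using (hasDerivAt_pow 2 u).hasDerivWithinAt
  rw [ofReal_P hr hrs]
  nth_rw 1 [← image_sq_Ioo]
  rw [MeasureTheory.lintegral_image_eq_lintegral_abs_deriv_mul measurableSet_Ioo hderiv hinj]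
  refine MeasureTheory.setLIntegral_congr_fun measurableSet_Ioo ?_
  rintro u ⟨h0, h1⟩
  have h1' : 0 < 1 - u := sub_pos.2 h1
  beta_reduce
  rw [← ENNReal.ofReal_mul (abs_nonneg _), abs_of_pos (by positivity),
    show 1 - u ^ 2 = (1 - u) * (1 + u) by ring, mul_rpow h1'.le (by positivity),
    ← rpow_natCast_mul h0.le, show 2 * r - 1 = (2 : ℕ) * (r - 1) + 1 by push_cast; ring,
    rpow_add h0, rpow_one]
  congr 1
  ring

lemma ofReal_P_eq_lintegral_landen {r s : ℝ} (hr : 0 < r) (hrs : r < s) :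
    ENNReal.ofReal (P r s) = ∫⁻ u in Set.Ioo (0 : ℝ) 1, ENNReal.ofReal
      (4 ^ r * u ^ (r - 1) * (1 - u) ^ (2 * (s - r) - 1) * (1 + u) ^ (2 - 2 * s) *
        (π * ellipticF (u ^ 2))) := by
  rw [ofReal_P hr hrs]
  nth_rw 1 [← image_landen_Ioo]
  rw [MeasureTheory.lintegral_image_eq_lintegral_abs_deriv_mul measurableSet_Ioo
    (fun u hu ↦ (hasDerivAt_landen (by linarith [hu.1])).hasDerivWithinAt) injOn_landen]
  refine MeasureTheory.setLIntegral_congr_fun measurableSet_Ioo ?_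
  rintro u ⟨h0, h1⟩
  have h1' : 0 < 1 - u := sub_pos.2 h1
  have hp : 0 < 1 + u := by positivity
  have hv : 1 - 4 * u / (1 + u) ^ 2 = (1 - u) ^ 2 / (1 + u) ^ 2 := by
    field_simp
    ring
  beta_reduce
  rw [← ENNReal.ofReal_mul (abs_nonneg _), abs_of_pos (by positivity), hv,
    ellipticF_landen h0.le h1, div_rpow (by positivity) (by positivity),
    div_rpow (by positivity) (by positivity), mul_rpow (by positivity) h0.le,
    ← rpow_natCast_mul hp.le, ← rpow_natCast_mul hp.le, ← rpow_natCast_mul h1'.le,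
    show 2 * (s - r) - 1 = (2 : ℕ) * (s - r - 1) + 1 by push_cast; ring,
    show 2 - 2 * s = 1 - (3 : ℕ) - (2 : ℕ) * (r - 1) - (2 : ℕ) * (s - r - 1) by
      push_cast; ring,
    rpow_add h1', rpow_sub hp, rpow_sub hp, rpow_sub hp, rpow_natCast,
    show (4 : ℝ) ^ r = 4 ^ (r - 1) * 4 by rw [← rpow_add_one (by norm_num), sub_add_cancel]]
  simp only [rpow_one]
  congr 1
  field_simp

lemma ofReal_two_rpow_mul_P {x s : ℝ} (hx : 0 < x) (hxs : 2 * x < s) :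
    ENNReal.ofReal (2 ^ (1 - 4 * x) * P (2 * x) s) = ∫⁻ u in Set.Ioo (0 : ℝ) 1, ENNReal.ofReal
      (2 * u ^ (2 * x - 1) * (1 - u) ^ (2 * (s - 2 * x) - 1) * (1 + u) ^ (2 - 2 * s) *
        (π * ellipticF (u ^ 2))) := by
  rw [ENNReal.ofReal_mul (by positivity), ofReal_P_eq_lintegral_landen (by positivity) hxs,
    ← MeasureTheory.lintegral_const_mul' _ _ ENNReal.ofReal_ne_top]
  congr 1 with u
  have h2 : (2 : ℝ) ^ (1 - 4 * x) * 4 ^ (2 * x) = 2 := by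
    rw [show (4 : ℝ) = 2 ^ (2 : ℝ) by norm_num, ← rpow_mul two_pos.le, ← rpow_add two_pos]
    norm_num
    ring_nf
    simp
  rw [← ENNReal.ofReal_mul (by positivity)]
  congr 1
  simp only [← mul_assoc, h2]

lemma measurable_ellipticF : Measurable ellipticF :=
  Measurable.tsum fun k ↦ by fun_prop

lemma two_rpow_mul_P_eq_add {x : ℝ} (hx : 0 < x) (hx' : x < 1 / 2) :
    2 ^ (1 - 4 * x) * P (2 * x) (1 / 2 + x) = P x (1 - x) + P (1 / 2 + x) (3 / 2 - x) := by
  have h1 := P_nonneg (r := x) (s := 1 - x) hx (by linarith)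
  have h2 := P_nonneg (r := 1 / 2 + x) (s := 3 / 2 - x) (by linarith) (by linarith)
  have h3 := P_nonneg (r := 2 * x) (s := 1 / 2 + x) (by linarith) (by linarith)
  rw [← ENNReal.ofReal_eq_ofReal_iff (by positivity) (by positivity), ENNReal.ofReal_add h1 h2,
    ofReal_two_rpow_mul_P hx (by linarith), ofReal_P_eq_lintegral_sq hx (by linarith),
    ofReal_P_eq_lintegral_sq (by linarith) (by linarith),
    ← MeasureTheory.lintegral_add_left (by have := measurable_ellipticF; fun_prop)]
  refine MeasureTheory.setLIntegral_congr_fun measurableSet_Ioo ?_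
  rintro u ⟨hu0, hu1⟩
  have hu1' : 0 < 1 - u := sub_pos.2 hu1
  have hp : 0 < 1 + u := by positivity
  have hF := ellipticF_nonneg (sq_nonneg u)
  beta_reduce
  rw [← ENNReal.ofReal_add (by positivity) (by positivity),
    show 2 * (1 / 2 + x - 2 * x) - 1 = -2 * x by ring,
    show 2 - 2 * (1 / 2 + x) = -2 * x + 1 by ring,
    show 2 * (1 / 2 + x) - 1 = 2 * x - 1 + 1 by ring, show 1 - x - x - 1 = -2 * x by ring,
    show 3 / 2 - x - (1 / 2 + x) - 1 = -2 * x by ring, rpow_add_one hp.ne',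
    rpow_add_one hu0.ne']
  congr 1
  ring

lemma two_rpow_mul_P_eq_sub {x : ℝ} (hx : 0 < x) (hx' : x < 1 / 2) :
    2 ^ (1 - 4 * x) * P (2 * x) (1 + x) = P x (1 - x) - P (1 / 2 + x) (3 / 2 - x) := by
  have h1 := P_nonneg (r := x) (s := 1 - x) hx (by linarith)
  have h2 := P_nonneg (r := 1 / 2 + x) (s := 3 / 2 - x) (by linarith) (by linarith)
  have h3 := P_nonneg (r := 2 * x) (s := 1 + x) (by linarith) (by linarith)
  rw [eq_sub_iff_add_eq, ← ENNReal.ofReal_eq_ofReal_iff (by positivity) h1,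
    ENNReal.ofReal_add (by positivity) h2,
    ofReal_two_rpow_mul_P hx (by linarith), ofReal_P_eq_lintegral_sq hx (by linarith),
    ofReal_P_eq_lintegral_sq (by linarith) (by linarith),
    ← MeasureTheory.lintegral_add_left (by have := measurable_ellipticF; fun_prop)]
  refine MeasureTheory.setLIntegral_congr_fun measurableSet_Ioo ?_
  rintro u ⟨hu0, hu1⟩
  have hu1' : 0 < 1 - u := sub_pos.2 hu1
  have hp : 0 < 1 + u := by positivity
  have hF := ellipticF_nonneg (sq_nonneg u)
  beta_reduce
  rw [← ENNReal.ofReal_add (by positivity) (by positivity),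
    show 2 * (1 + x - 2 * x) - 1 = -2 * x + 1 by ring,
    show 2 - 2 * (1 + x) = -2 * x by ring,
    show 2 * (1 / 2 + x) - 1 = 2 * x - 1 + 1 by ring, show 1 - x - x - 1 = -2 * x by ring,
    show 3 / 2 - x - (1 / 2 + x) - 1 = -2 * x by ring, rpow_add_one hu1'.ne',
    rpow_add_one hu0.ne']
  congr 1
  ring

/-- The pair of `P`-value relations from Proposition 5.2 of the paper. -/
theorem P_relation_G2 (m j : ℕ) (hm : m = 1 ∨ m = 2 ∨ m = 3)
    (hj0 : 0 < j) (hj : j < 12 / m) (hgcd : Nat.gcd j (12 / m) = 1) :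
    (2 : ℝ) ^ ((1 : ℝ) - (m * j : ℝ) / 6) * P ((m * j : ℝ) / 12) (1/2 + (m * j : ℝ) / 24)
        = P ((m * j : ℝ) / 24) (1 - (m * j : ℝ) / 24)
          + P (1/2 + (m * j : ℝ) / 24) (3/2 - (m * j : ℝ) / 24) ∧
    (2 : ℝ) ^ ((1 : ℝ) - (m * j : ℝ) / 6) * P ((m * j : ℝ) / 12) (1 + (m * j : ℝ) / 24)
        = P ((m * j : ℝ) / 24) (1 - (m * j : ℝ) / 24)
          - P (1/2 + (m * j : ℝ) / 24) (3/2 - (m * j : ℝ) / 24) := by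
  have hlt : m * j < 12 := by
    rcases hm with rfl | rfl | rfl <;> omega
  have hpos : 0 < m * j := by
    rcases hm with rfl | rfl | rfl <;> omega
  have hlt' : (m * j : ℝ) < 12 := by exact_mod_cast hlt
  have hpos' : (0 : ℝ) < m * j := by exact_mod_cast hpos
  have hx : 0 < (m * j : ℝ) / 24 := by positivity
  have hx' : (m * j : ℝ) / 24 < 1 / 2 := by linarith
  have h6 : (m * j : ℝ) / 6 = 4 * (m * j / 24) := by ring
  have h12 : (m * j : ℝ) / 12 = 2 * (m * j / 24) := by ring
  rw [h6, h12]
  exact ⟨two_rpow_mul_P_eq_add hx hx', two_rpow_mul_P_eq_sub hx hx'⟩
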